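/- arXiv:2207.05421 — 5 statements merged into one kernel-verified Lean document; each statement's English description precedes it below -/
import Mathlib

section
/- Let f : ℝⁿ → ℝⁿ be locally Lipschitz with f(0) = 0, and let V : ℝⁿ → ℝ be continuously differentiable with V(0) = 0 and V(x) > 0 for all x ≠ 0. Let γ > 0 be such that the sublevel set Ω_γ := {x ∈ ℝⁿ : V(x) ≤ γ} is bounded and ∇V(x) · f(x) < 0 for every x ∈ Ω_γ with x ≠ 0. Then the origin is an asymptotically stable equilibrium of ẋ = f(x) and Ω_γ is contained in the region of attraction of the origin. -/
open Filter Topology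

section

open Set Metric

variable {E : Type*} [NormedAddCommGroup E] [NormedSpace ℝ E] {f : E → E} {V : E → ℝ}

/-- Local solutions of `ẋ = f x` starting in a compact set exist on a common time interval. -/
theorem LocallyLipschitz.exists_uniform_time_solution [ProperSpace E] (hf : LocallyLipschitz f)
    {s : Set E} (hs : IsCompact s) :
    ∃ ε > (0 : ℝ), ∀ p ∈ s, ∃ y : ℝ → E, y 0 = p ∧
      ∀ t ∈ Ioo (-ε) ε, HasDerivAt y (f (y t)) t := by
  have hc : IsCompact (cthickening 1 s) := hs.cthickening
  obtain ⟨K, hK⟩ :=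
    (hf.locallyLipschitzOn (s := cthickening 1 s)).exists_lipschitzOnWith_of_compact hc
  obtain ⟨M, hM⟩ := hc.exists_bound_of_continuousOn hf.continuous.continuousOn
  set L : NNReal := M.toNNReal + 1 with hL
  have hLpos : (0 : ℝ) < L := by positivity
  have hML : M ≤ L := by
    have := Real.le_coe_toNNReal M
    push_cast [hL]
    linarith
  have hε : (0 : ℝ) < (L : ℝ)⁻¹ := inv_pos.2 hLpos
  refine ⟨(L : ℝ)⁻¹, hε, fun p hp ↦ ?_⟩
  have hball : closedBall p ((1 : NNReal) : ℝ) ⊆ cthickening 1 s :=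
    closedBall_subset_cthickening hp 1
  have hpl : IsPicardLindelof (fun _ ↦ f)
      (⟨0, by constructor <;> linarith⟩ : Icc (-(L : ℝ)⁻¹) (L : ℝ)⁻¹) p 1 0 L K := by
    refine .of_time_independent (fun x hx ↦ (hM x (hball hx)).trans hML) (hK.mono hball) ?_
    simp [hLpos.ne']
  obtain ⟨y, hy0, hy⟩ := hpl.exists_eq_forall_mem_Icc_hasDerivWithinAt₀
  exact ⟨y, hy0, fun t ht ↦ (hy t (Ioo_subset_Icc_self ht)).hasDerivAt (Icc_mem_nhds ht.1 ht.2)⟩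

/-- If every point of `s` is the start of a local solution, on a time interval of uniform length,
which is again in `s` after time `T`, then the local solutions can be concatenated. -/
theorem exists_forall_nonneg_hasDerivAt_of_uniform_time {s : Set E} {T : ℝ} (hT : 0 < T)
    (h : ∀ p ∈ s, ∃ y : ℝ → E, y 0 = p ∧ y T ∈ s ∧ ∀ t ∈ Icc 0 T, HasDerivAt y (f (y t)) t)
    {p : E} (hp : p ∈ s) :
    ∃ x : ℝ → E, x 0 = p ∧ ∀ t, 0 ≤ t → HasDerivAt x (f (x t)) t := by
  choose! φ hφ0 hφT hφ using h
  let q : ℕ → E := fun k ↦ (fun z ↦ φ z T)^[k] p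
  have hqs : ∀ k, q (k + 1) = φ (q k) T := fun k ↦ Function.iterate_succ_apply' _ _ _
  have hq : ∀ k, q k ∈ s := by
    intro k
    induction k with
    | zero => exact hp
    | succ k ih => rw [hqs]; exact hφT _ ih
  let x : ℝ → E := fun t ↦ φ (q ⌊t / T⌋₊) (t - ⌊t / T⌋₊ * T)
  have hx : ∀ (k : ℕ) (t : ℝ), k * T ≤ t → t ≤ (k + 1) * T → x t = φ (q k) (t - k * T) := by
    intro k t h1 h2
    rcases h2.lt_or_eq with h2 | rfl
    · have : ⌊t / T⌋₊ = k := by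
        rw [Nat.floor_eq_iff (div_nonneg ((by positivity : (0 : ℝ) ≤ k * T).trans h1) hT.le)]
        exact ⟨(le_div_iff₀ hT).2 h1, (div_lt_iff₀ hT).2 h2⟩
      simp only [x, this]
    · have : ⌊((k : ℝ) + 1) * T / T⌋₊ = k + 1 := by
        rw [mul_div_cancel_right₀ _ hT.ne']
        exact_mod_cast Nat.floor_natCast (k + 1)
      simp only [x, this, hqs]
      push_cast
      rw [sub_self, hφ0 _ (hφT _ (hq k))]
      congr 1
      ring
  have hneg : ∀ t ≤ T, x t = φ (q 0) t := by
    intro t ht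
    rcases le_total 0 t with h0 | h0
    · simpa using hx 0 t (by simpa using h0) (by simpa using ht)
    · have : ⌊t / T⌋₊ = 0 := Nat.floor_of_nonpos (div_nonpos_of_nonpos_of_nonneg h0 hT.le)
      simp [x, this]
  have hd : ∀ (k : ℕ) (t : ℝ), k * T ≤ t → t ≤ (k + 1) * T →
      HasDerivWithinAt x (f (x t)) (Icc (k * T) ((k + 1) * T)) t := by
    intro k t h1 h2
    have hder := (hφ (q k) (hq k) (t - k * T) ⟨by linarith, by linarith⟩).comp_sub_const t (k * T)
    rw [← hx k t h1 h2] at hder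
    exact hder.hasDerivWithinAt.congr (fun u hu ↦ hx k u hu.1 hu.2) (hx k t h1 h2)
  refine ⟨x, by rw [hneg 0 hT.le, hφ0 _ (hq 0)]; rfl, fun t ht ↦ ?_⟩
  rcases lt_or_ge t T with htT | htT
  · have hder := hφ (q 0) (hq 0) t ⟨ht, htT.le⟩
    rw [← hneg t htT.le] at hder
    refine hder.congr_of_eventuallyEq ?_
    filter_upwards [Iio_mem_nhds htT] with u hu using hneg u (le_of_lt hu)
  · obtain ⟨k, hk⟩ : ∃ k, ⌊t / T⌋₊ = k + 1 :=
      Nat.exists_eq_succ_of_ne_zero (Nat.floor_pos.2 ((one_le_div hT).2 htT)).ne'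
    rw [Nat.floor_eq_iff (by positivity), le_div_iff₀ hT, div_lt_iff₀ hT] at hk
    obtain ⟨hk1, hk2⟩ := hk
    have hright := hd (k + 1) t hk1 hk2.le
    rcases hk1.lt_or_eq with hk1 | hk1
    · exact hright.hasDerivAt (Icc_mem_nhds hk1 hk2)
    · push_cast at hk1 hk2 hright
      have hleft := hd k t (by linarith) hk1.ge
      refine (hleft.union hright).hasDerivAt ?_
      rw [Icc_union_Icc_eq_Icc (by linarith) (by linarith)]
      exact Icc_mem_nhds (by linarith) hk2

/-- A sublevel set of `V` is forward invariant if `V` decreases along `f` on its level set. -/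
theorem le_of_hasDerivAt_of_fderiv_neg (hV : Differentiable ℝ V) {c : ℝ}
    (hdec : ∀ x, V x = c → fderiv ℝ V x (f x) < 0) {x : ℝ → E} {T : ℝ}
    (hx : ∀ t ∈ Icc 0 T, HasDerivAt x (f (x t)) t) (h0 : V (x 0) ≤ c) :
    ∀ t ∈ Icc 0 T, V (x t) ≤ c := by
  have hd : ∀ t ∈ Icc 0 T, HasDerivAt (V ∘ x) (fderiv ℝ V (x t) (f (x t))) t := fun t ht ↦
    (hV (x t)).hasFDerivAt.comp_hasDerivAt t (hx t ht)
  exact image_le_of_deriv_right_lt_deriv_boundary (f := V ∘ x) (B := fun _ ↦ c) (B' := fun _ ↦ 0)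
    (fun t ht ↦ (hd t ht).continuousAt.continuousWithinAt)
    (fun t ht ↦ (hd t (Ico_subset_Icc_self ht)).hasDerivWithinAt) h0
    (fun t ↦ hasDerivAt_const t c) (fun t _ h ↦ hdec _ h)

/-- A positive definite function with a compact sublevel set controls the distance to the
origin. -/
theorem exists_pos_forall_lt_imp_norm_lt {F : Type*} [NormedAddCommGroup F] {V : F → ℝ}
    (hV : Continuous V) (hVpos : ∀ x, x ≠ 0 → 0 < V x) {γ : ℝ} (hγ : 0 < γ)
    (hc : IsCompact {x | V x ≤ γ}) {r : ℝ} (hr : 0 < r) :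
    ∃ m > (0 : ℝ), m ≤ γ ∧ ∀ x, V x < m → ‖x‖ < r := by
  have hc' : IsCompact ({x | V x ≤ γ} ∩ {x | r ≤ ‖x‖}) :=
    hc.inter_right (isClosed_le continuous_const continuous_norm)
  obtain ⟨m, hm, hmV⟩ := hc'.exists_forall_le' (f := V) (a := 0) hV.continuousOn
    (fun x hx ↦ hVpos x (norm_pos_iff.1 (hr.trans_le hx.2)))
  refine ⟨min m γ, lt_min hm hγ, min_le_right _ _, fun x hx ↦ ?_⟩
  by_contra! hxr
  exact (hmV x ⟨(hx.trans_le (min_le_right _ _)).le, hxr⟩).not_gt (hx.trans_le (min_le_left _ _))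

/-- Along a solution that stays in a compact sublevel set on which `V` strictly decreases, `V`
eventually drops below every positive level. -/
theorem eventually_lt_of_fderiv_neg (hf : Continuous f) (hV : ContDiff ℝ 1 V) (hV0 : V 0 = 0)
    {γ : ℝ} (hc : IsCompact {x | V x ≤ γ})
    (hdec : ∀ x, V x ≤ γ → x ≠ 0 → fderiv ℝ V x (f x) < 0) {x : ℝ → E}
    (hx : ∀ t, 0 ≤ t → HasDerivAt x (f (x t)) t) (hanti : AntitoneOn (V ∘ x) (Ici 0))
    (h0 : V (x 0) ≤ γ) {ε : ℝ} (hε : 0 < ε) :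
    ∀ᶠ t in atTop, V (x t) < ε := by
  suffices ∃ t, 0 ≤ t ∧ V (x t) < ε by
    obtain ⟨t, ht, htε⟩ := this
    filter_upwards [eventually_ge_atTop t] with u hu
    exact (hanti ht (ht.trans hu : (0 : ℝ) ≤ u) hu).trans_lt htε
  by_contra! hge
  have hle : ∀ t, 0 ≤ t → V (x t) ≤ γ := fun t ht ↦
    (hanti (mem_Ici.2 le_rfl) (mem_Ici.2 ht) ht).trans h0
  have hc' : IsCompact ({x | V x ≤ γ} ∩ {x | ε ≤ V x}) :=
    hc.inter_right (isClosed_le continuous_const hV.continuous)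
  obtain ⟨m, hm, hmV⟩ := hc'.exists_forall_le' (f := fun z ↦ -fderiv ℝ V z (f z)) (a := 0)
    ((hV.continuous_fderiv one_ne_zero).clm_apply hf).neg.continuousOn
    (fun z hz ↦ neg_pos.2 <| hdec z hz.1 <| by
      rintro rfl
      exact (hε.trans_le hz.2).ne' hV0)
  have hd : ∀ t, 0 ≤ t → HasDerivAt (V ∘ x) (fderiv ℝ V (x t) (f (x t))) t := fun t ht ↦
    (hV.differentiable one_ne_zero (x t)).hasFDerivAt.comp_hasDerivAt t (hx t ht)
  have hlin := (convex_Ici (0 : ℝ)).image_sub_le_mul_sub_of_deriv_le (f := V ∘ x) (C := -m)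
    (fun t ht ↦ (hd t ht).continuousAt.continuousWithinAt)
    (fun t ht ↦ (hd t (interior_subset ht)).differentiableAt.differentiableWithinAt)
    (fun t ht ↦ by
      have ht' : (0 : ℝ) ≤ t := interior_subset ht
      rw [(hd t ht').deriv]
      linarith [hmV (x t) ⟨hle t ht', hge t ht'⟩])
  have hγ : 0 < γ := hε.trans_le ((hge 0 le_rfl).trans h0)
  have htime : 0 ≤ γ / m := by positivity
  have hdrop := hlin 0 (mem_Ici.2 le_rfl) (γ / m) htime htime
  have hmul : -m * (γ / m - 0) = -γ := by field_simp; ring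
  rw [hmul] at hdrop
  simp only [Function.comp_apply] at hdrop
  linarith [hge (γ / m) htime]

/-- Every point of a compact sublevel set on which `V` strictly decreases along `f` is the start of
a global forward solution, along which `V` does not increase and which converges to the origin. -/
theorem exists_solution_antitoneOn_tendsto_zero [ProperSpace E] (hf : LocallyLipschitz f)
    (hf0 : f 0 = 0) (hV : ContDiff ℝ 1 V) (hV0 : V 0 = 0) (hVpos : ∀ x, x ≠ 0 → 0 < V x)
    {γ : ℝ} (hγ : 0 < γ) (hc : IsCompact {x | V x ≤ γ})
    (hdec : ∀ x, V x ≤ γ → x ≠ 0 → fderiv ℝ V x (f x) < 0) {x₀ : E} (hx₀ : V x₀ ≤ γ) :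
    ∃ x : ℝ → E, x 0 = x₀ ∧ (∀ t, 0 ≤ t → HasDerivAt x (f (x t)) t) ∧
      AntitoneOn (V ∘ x) (Ici 0) ∧ Tendsto x atTop (𝓝 0) := by
  have hVd : Differentiable ℝ V := hV.differentiable one_ne_zero
  have hbdry : ∀ z, V z = γ → fderiv ℝ V z (f z) < 0 := fun z hz ↦ hdec z hz.le <| by
    rintro rfl
    exact hγ.ne (hV0.symm.trans hz)
  obtain ⟨ε, hε, hloc⟩ := hf.exists_uniform_time_solution hc
  obtain ⟨x, hx0, hx⟩ := exists_forall_nonneg_hasDerivAt_of_uniform_time (f := f)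
    (s := {x | V x ≤ γ}) (half_pos hε) (fun p hp ↦ by
      obtain ⟨y, hy0, hy⟩ := hloc p hp
      have hy' : ∀ t ∈ Icc 0 (ε / 2), HasDerivAt y (f (y t)) t := fun t ht ↦
        hy t ⟨by linarith [ht.1], by linarith [ht.2]⟩
      exact ⟨y, hy0, le_of_hasDerivAt_of_fderiv_neg hVd hbdry hy' (hy0 ▸ hp) _
        ⟨by positivity, le_rfl⟩, hy'⟩) hx₀
  have h0 : V (x 0) ≤ γ := hx0 ▸ hx₀
  have hle : ∀ t, 0 ≤ t → V (x t) ≤ γ := fun t ht ↦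
    le_of_hasDerivAt_of_fderiv_neg hVd hbdry (fun u hu ↦ hx u hu.1) h0 t ⟨ht, le_rfl⟩
  have hd : ∀ t, 0 ≤ t → HasDerivAt (V ∘ x) (fderiv ℝ V (x t) (f (x t))) t := fun t ht ↦
    (hVd (x t)).hasFDerivAt.comp_hasDerivAt t (hx t ht)
  have hanti : AntitoneOn (V ∘ x) (Ici 0) := by
    refine antitoneOn_of_hasDerivWithinAt_nonpos (convex_Ici 0)
      (fun t ht ↦ (hd t ht).continuousAt.continuousWithinAt)
      (fun t ht ↦ (hd t (interior_subset ht)).hasDerivWithinAt) (fun t ht ↦ ?_)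
    by_cases hxt : x t = 0
    · simp [hxt, hf0]
    · exact (hdec _ (hle t (interior_subset ht)) hxt).le
  refine ⟨x, hx0, hx, hanti, Metric.tendsto_nhds.2 fun r hr ↦ ?_⟩
  obtain ⟨m, hm, -, hmr⟩ := exists_pos_forall_lt_imp_norm_lt hV.continuous hVpos hγ hc hr
  filter_upwards [eventually_lt_of_fderiv_neg hf.continuous hV hV0 hc hdec hx hanti h0 hm] with t ht
  simpa using hmr _ ht

end

/-- If `V` is a continuously differentiable positive definite function, the sublevel set
`Ω_γ = {x | V x ≤ γ}` is bounded, and the derivative of `V` along the locally Lipschitz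
vector field `f` is negative on `Ω_γ \ {0}`, then the origin is asymptotically stable
(Lyapunov stable and attractive) and `Ω_γ` is contained in the region of attraction. -/
theorem lyapunov_sublevel_subset_roa {n : ℕ}
    (f : EuclideanSpace ℝ (Fin n) → EuclideanSpace ℝ (Fin n))
    (hf : LocallyLipschitz f) (hf0 : f 0 = 0)
    (V : EuclideanSpace ℝ (Fin n) → ℝ) (hV : ContDiff ℝ 1 V)
    (hV0 : V 0 = 0) (hVpos : ∀ x : EuclideanSpace ℝ (Fin n), x ≠ 0 → 0 < V x)
    (γ : ℝ) (hγ : 0 < γ)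
    (hbdd : Bornology.IsBounded {x : EuclideanSpace ℝ (Fin n) | V x ≤ γ})
    (hdec : ∀ x : EuclideanSpace ℝ (Fin n), V x ≤ γ → x ≠ 0 → fderiv ℝ V x (f x) < 0) :
    -- the origin is Lyapunov stable
    ((∀ ε > (0:ℝ), ∃ δ > (0:ℝ), ∀ x₀ : EuclideanSpace ℝ (Fin n), ‖x₀‖ < δ →
        ∃ x : ℝ → EuclideanSpace ℝ (Fin n), x 0 = x₀ ∧
          (∀ t : ℝ, 0 ≤ t → HasDerivAt x (f (x t)) t) ∧
          (∀ t : ℝ, 0 ≤ t → ‖x t‖ < ε)) ∧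
      -- the origin is attractive
      (∃ δ' > (0:ℝ), ∀ x₀ : EuclideanSpace ℝ (Fin n), ‖x₀‖ < δ' →
        ∃ x : ℝ → EuclideanSpace ℝ (Fin n), x 0 = x₀ ∧
          (∀ t : ℝ, 0 ≤ t → HasDerivAt x (f (x t)) t) ∧
          Tendsto x atTop (𝓝 0))) ∧
    -- Ω_γ is contained in the region of attraction
    (∀ x₀ : EuclideanSpace ℝ (Fin n), V x₀ ≤ γ →
      ∃ x : ℝ → EuclideanSpace ℝ (Fin n), x 0 = x₀ ∧
        (∀ t : ℝ, 0 ≤ t → HasDerivAt x (f (x t)) t) ∧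
        Tendsto x atTop (𝓝 0)) := by
  have hc : IsCompact {x | V x ≤ γ} :=
    Metric.isCompact_of_isClosed_isBounded (isClosed_le hV.continuous continuous_const) hbdd
  have hsol := fun x₀ (hx₀ : V x₀ ≤ γ) ↦
    exists_solution_antitoneOn_tendsto_zero hf hf0 hV hV0 hVpos hγ hc hdec hx₀
  have hnear : ∀ m > (0 : ℝ), ∃ δ > (0 : ℝ), ∀ x₀, ‖x₀‖ < δ → V x₀ < m := by
    intro m hm
    obtain ⟨δ, hδ, h⟩ := Metric.eventually_nhds_iff.1
      (hV.continuous.continuousAt.eventually_lt_const (by rwa [hV0] : V 0 < m))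
    exact ⟨δ, hδ, fun x₀ hx₀ ↦ h (by simpa using hx₀)⟩
  have hroa : ∀ x₀, V x₀ ≤ γ → ∃ x : ℝ → EuclideanSpace ℝ (Fin n), x 0 = x₀ ∧
      (∀ t : ℝ, 0 ≤ t → HasDerivAt x (f (x t)) t) ∧ Tendsto x atTop (𝓝 0) := by
    intro x₀ hx₀
    obtain ⟨x, hx0, hx, -, hlim⟩ := hsol x₀ hx₀
    exact ⟨x, hx0, hx, hlim⟩
  refine ⟨⟨fun ε hε ↦ ?_, ?_⟩, hroa⟩
  · obtain ⟨m, hm, hmγ, hmε⟩ := exists_pos_forall_lt_imp_norm_lt hV.continuous hVpos hγ hc hε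
    obtain ⟨δ, hδ, hδm⟩ := hnear m hm
    refine ⟨δ, hδ, fun x₀ hx₀ ↦ ?_⟩
    obtain ⟨x, hx0, hx, hanti, -⟩ := hsol x₀ ((hδm x₀ hx₀).le.trans hmγ)
    refine ⟨x, hx0, hx, fun t ht ↦ hmε _ ?_⟩
    exact (hanti (Set.mem_Ici.2 le_rfl) (Set.mem_Ici.2 ht) ht).trans_lt
      (by simpa [hx0] using hδm x₀ hx₀)
  · obtain ⟨δ, hδ, hδγ⟩ := hnear γ hγ
    exact ⟨δ, hδ, fun x₀ hx₀ ↦ hroa x₀ (hδγ x₀ hx₀).le⟩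
end

section
/- Let f : ℝⁿ → ℝⁿ be locally Lipschitz with f(0) = 0, and let V : ℝⁿ → ℝ be continuously differentiable with V(0) = 0 and V(x) > 0 for all x ≠ 0. Let γ > 0 be such that Ω_γ := {x ∈ ℝⁿ : V(x) ≤ γ} is bounded and ∇V(x) · f(x) < 0 for every x ∈ Ω_γ with x ≠ 0. Then Ω_γ is positively invariant: every solution of ẋ = f(x) with x(0) ∈ Ω_γ is defined for all t ≥ 0 and satisfies x(t) ∈ Ω_γ for all t ≥ 0. -/
open Filter Topology

open scoped NNReal

/-- A bounded, globally Lipschitz vector field on a Banach space has a global integral curve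
through every point. -/
theorem LipschitzWith.exists_hasDerivAt_of_bounded {E : Type*} [NormedAddCommGroup E]
    [NormedSpace ℝ E] [CompleteSpace E] {g : E → E} {K L : ℝ≥0} (hg : LipschitzWith K g)
    (hL : ∀ x, ‖g x‖ ≤ L) (x₀ : E) :
    ∃ x : ℝ → E, x 0 = x₀ ∧ ∀ t, HasDerivAt x (g (x t)) t := by
  have solution_on_Ioo (T : ℝ≥0) :
      ∃ α : ℝ → E, α 0 = x₀ ∧ ∀ t ∈ Set.Ioo (-T : ℝ) T, HasDerivAt α (g (α t)) t := by
    have hT : (0 : ℝ) ∈ Set.Icc (-T : ℝ) T := by simp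
    have hPL : IsPicardLindelof (fun _ ↦ g) (⟨0, hT⟩ : Set.Icc (-T : ℝ) T) x₀ (L * T) 0 L K :=
      .of_time_independent (fun x _ ↦ hL x) hg.lipschitzOnWith (by simp)
    obtain ⟨α, hα0, hα⟩ := hPL.exists_eq_forall_mem_Icc_hasDerivWithinAt₀
    exact ⟨α, hα0, fun t ht ↦ (hα t (Set.Ioo_subset_Icc_self ht)).hasDerivAt
      (Icc_mem_nhds ht.1 ht.2)⟩
  choose α hα0 hα using solution_on_Ioo
  have agree {S T : ℝ≥0} {t : ℝ} (hS : |t| < S) (hT : |t| < T) : α S t = α T t := by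
    have hm : |t| < min (S : ℝ) T := lt_min hS hT
    have hpos : 0 < min (S : ℝ) T := (abs_nonneg t).trans_lt hm
    refine ODE_solution_unique_of_mem_Ioo (v := fun _ ↦ g) (s := fun _ ↦ Set.univ) (K := K)
      (a := -min (S : ℝ) T) (b := min (S : ℝ) T) (t₀ := 0)
      (fun _ _ ↦ hg.lipschitzOnWith) ⟨neg_lt_zero.2 hpos, hpos⟩
      (fun u hu ↦ ⟨hα S u ?_, trivial⟩) (fun u hu ↦ ⟨hα T u ?_, trivial⟩)
      ((hα0 S).trans (hα0 T).symm) (abs_lt.1 hm)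
    · exact abs_lt.1 ((abs_lt.2 hu).trans_le (min_le_left _ _))
    · exact abs_lt.1 ((abs_lt.2 hu).trans_le (min_le_right _ _))
  have lt_bound (t : ℝ) : |t| < (‖t‖₊ + 1 : ℝ≥0) := by simp
  refine ⟨fun t ↦ α (‖t‖₊ + 1) t, hα0 _, fun t ↦ ?_⟩
  refine (hα _ t (abs_lt.1 (lt_bound t))).congr_of_eventuallyEq ?_
  filter_upwards [continuous_abs.continuousAt.eventually_lt_const (lt_bound t)] with s hs
  exact agree (lt_bound s) hs

/-- A locally Lipschitz map into Euclidean space agrees on any given compact set with a bounded,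
globally Lipschitz map. -/
theorem LocallyLipschitz.exists_bounded_lipschitzWith_eqOn {α : Type*} [PseudoMetricSpace α]
    {n : ℕ} {f : α → EuclideanSpace ℝ (Fin n)} (hf : LocallyLipschitz f) {s : Set α}
    (hs : IsCompact s) :
    ∃ (g : α → EuclideanSpace ℝ (Fin n)) (K L : ℝ≥0),
      LipschitzWith K g ∧ (∀ x, ‖g x‖ ≤ L) ∧ Set.EqOn f g s := by
  obtain ⟨K, hK⟩ := (hf.locallyLipschitzOn (s := s)).exists_lipschitzOnWith_of_compact hs
  obtain ⟨h, hh, hfh⟩ := hK.extend_finite_dimension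
  obtain ⟨M, hM⟩ := hs.exists_bound_of_continuousOn hf.continuous.continuousOn
  let clamp : ℝ → ℝ := fun r ↦ max (-|M|) (min |M| r)
  have hclamp : LipschitzWith 1 clamp := (LipschitzWith.id.const_min _).const_max _
  have clamp_le (r : ℝ) : ‖clamp r‖ ≤ |M| :=
    abs_le.2 ⟨le_max_left _ _, max_le (neg_le_self (abs_nonneg M)) (min_le_left _ _)⟩
  have hpi : LipschitzWith 1 fun (v : Fin n → ℝ) i ↦ clamp (v i) :=
    LipschitzWith.of_dist_le_mul fun v w ↦ by
      refine (dist_pi_le_iff (by positivity)).2 fun i ↦ (hclamp.dist_le_mul _ _).trans ?_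
      gcongr
      exact dist_le_pi_dist v w i
  obtain ⟨C, hC⟩ : ∃ C, LipschitzWith C (WithLp.toLp 2 : (Fin n → ℝ) → EuclideanSpace ℝ (Fin n)) :=
    ⟨_, PiLp.lipschitzWith_toLp 2 _⟩
  have hbound (v : Fin n → ℝ) (hv : ‖v‖ ≤ |M|) : ‖WithLp.toLp 2 v‖ ≤ C * ‖M‖₊ :=
    (hC.norm_le_mul (by simp) v).trans (mul_le_mul_of_nonneg_left hv C.coe_nonneg)
  refine ⟨fun x ↦ WithLp.toLp 2 fun i ↦ clamp (h x i), _, C * ‖M‖₊,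
    hC.comp (hpi.comp ((PiLp.lipschitzWith_ofLp 2 _).comp hh)),
    fun x ↦ hbound _ ((pi_norm_le_iff_of_nonneg (abs_nonneg M)).2 fun i ↦ clamp_le _), ?_⟩
  intro x hx
  ext i
  have hi : |f x i| ≤ |M| := (PiLp.norm_apply_le (f x) i).trans ((hM x hx).trans (le_abs_self M))
  rw [abs_le] at hi
  simp [clamp, ← hfh hx, hi.1, hi.2]

/-- If `V` strictly decreases along the vector field `g` on the level set `V = γ`, then solutions
of `ẋ = g x` cannot leave the sublevel set `V ≤ γ` in forward time. -/
theorem sublevel_invariant_of_fderiv_neg {E : Type*} [NormedAddCommGroup E] [NormedSpace ℝ E]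
    {g : E → E} {V : E → ℝ} (hV : Differentiable ℝ V) {γ : ℝ}
    (hdec : ∀ x, V x = γ → fderiv ℝ V x (g x) < 0) {x : ℝ → E} {T : ℝ} (h0 : V (x 0) ≤ γ)
    (hx : ∀ t ∈ Set.Ico 0 T, HasDerivAt x (g (x t)) t) :
    ∀ t ∈ Set.Ico 0 T, V (x t) ≤ γ := by
  intro t ht
  have hd : ∀ u ∈ Set.Icc 0 t, HasDerivAt (V ∘ x) (fderiv ℝ V (x u) (g (x u))) u := fun u hu ↦
    (hV (x u)).hasFDerivAt.comp_hasDerivAt u (hx u ⟨hu.1, hu.2.trans_lt ht.2⟩)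
  exact image_le_of_deriv_right_lt_deriv_boundary (B := fun _ ↦ γ) (B' := fun _ ↦ 0)
    (fun u hu ↦ (hd u hu).continuousAt.continuousWithinAt)
    (fun u hu ↦ (hd u (Set.Ico_subset_Icc_self hu)).hasDerivWithinAt) h0
    (fun u ↦ hasDerivAt_const u γ) (fun u _ hu ↦ hdec _ hu) ⟨ht.1, le_rfl⟩

/-- Under the Lyapunov conditions of Lemma 1, the bounded sublevel set
`Ω_γ = {x | V x ≤ γ}` is positively invariant: every solution of `ẋ = f x` starting
in `Ω_γ` is defined for all `t ≥ 0` and stays in `Ω_γ`, and moreover any solution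
defined on a forward interval `[0, T)` starting in `Ω_γ` remains in `Ω_γ` there. -/
theorem lyapunov_sublevel_positively_invariant {n : ℕ}
    (f : EuclideanSpace ℝ (Fin n) → EuclideanSpace ℝ (Fin n))
    (hf : LocallyLipschitz f) (hf0 : f 0 = 0)
    (V : EuclideanSpace ℝ (Fin n) → ℝ) (hV : ContDiff ℝ 1 V)
    (hV0 : V 0 = 0) (hVpos : ∀ x : EuclideanSpace ℝ (Fin n), x ≠ 0 → 0 < V x)
    (γ : ℝ) (hγ : 0 < γ)
    (hbdd : Bornology.IsBounded {x : EuclideanSpace ℝ (Fin n) | V x ≤ γ})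
    (hdec : ∀ x : EuclideanSpace ℝ (Fin n), V x ≤ γ → x ≠ 0 → fderiv ℝ V x (f x) < 0) :
    -- a globally defined solution exists from every point of Ω_γ and stays in Ω_γ
    (∀ x₀ : EuclideanSpace ℝ (Fin n), V x₀ ≤ γ →
      ∃ x : ℝ → EuclideanSpace ℝ (Fin n), x 0 = x₀ ∧
        (∀ t : ℝ, 0 ≤ t → HasDerivAt x (f (x t)) t) ∧
        (∀ t : ℝ, 0 ≤ t → V (x t) ≤ γ)) ∧
    -- every solution starting in Ω_γ remains in Ω_γ on its interval of existence
    (∀ x : ℝ → EuclideanSpace ℝ (Fin n), ∀ T : ℝ, V (x 0) ≤ γ →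
      (∀ t ∈ Set.Ico (0:ℝ) T, HasDerivAt x (f (x t)) t) →
      ∀ t ∈ Set.Ico (0:ℝ) T, V (x t) ≤ γ) := by
  have hVd : Differentiable ℝ V := hV.differentiable one_ne_zero
  have hlevel : ∀ x, V x = γ → fderiv ℝ V x (f x) < 0 := fun x hx ↦
    hdec x hx.le (by rintro rfl; exact hγ.ne (hV0.symm.trans hx))
  refine ⟨fun x₀ hx₀ ↦ ?_, fun x T h0 hx ↦ sublevel_invariant_of_fderiv_neg hVd hlevel h0 hx⟩
  have hcompact : IsCompact {x | V x ≤ γ} :=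
    Metric.isCompact_of_isClosed_isBounded (isClosed_le hV.continuous continuous_const) hbdd
  obtain ⟨g, K, L, hg, hL, hfg⟩ := hf.exists_bounded_lipschitzWith_eqOn hcompact
  obtain ⟨x, hx0, hx⟩ := hg.exists_hasDerivAt_of_bounded hL x₀
  have hmem : ∀ t, 0 ≤ t → V (x t) ≤ γ := fun t ht ↦
    sublevel_invariant_of_fderiv_neg hVd
      (fun y hy ↦ hfg (show y ∈ {z | V z ≤ γ} from hy.le) ▸ hlevel y hy)
      (hx0 ▸ hx₀) (fun u _ ↦ hx u) t ⟨ht, lt_add_one t⟩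
  exact ⟨x, hx0, fun t ht ↦ hfg (hmem t ht) ▸ hx t, hmem⟩
end

section
/- Let τ ∈ (0, 2] and let R₁, R₂ : ℝⁿ → ℝ. Define R_∪(R₁,R₂)(x) := R₁(x) + R₂(x) + √(R₁(x)² + R₂(x)² − τ R₁(x) R₂(x)). Then {x ∈ ℝⁿ : R_∪(R₁,R₂)(x) > 0} = {x ∈ ℝⁿ : R₁(x) > 0} ∪ {x ∈ ℝⁿ : R₂(x) > 0}; that is, the R-union represents the set-theoretic union of the positivity regions of R₁ and R₂. -/
theorem add_add_sqrt_pos_of_pos {τ a b : ℝ} (hτ : 0 < τ) (ha : 0 < a) :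
    0 < a + b + √(a ^ 2 + b ^ 2 - τ * (a * b)) := by
  rcases le_or_gt 0 b with hb | hb
  · positivity
  · have hab : 0 < τ * (a * -b) := by
      have := neg_pos.mpr hb
      positivity
    have : -b ≤ √(a ^ 2 + b ^ 2 - τ * (a * b)) := by
      apply Real.le_sqrt_of_sq_le
      nlinarith [sq_nonneg a]
    linarith

theorem add_add_sqrt_nonpos {τ a b : ℝ} (hτ : 0 ≤ τ) (ha : a ≤ 0) (hb : b ≤ 0) :
    a + b + √(a ^ 2 + b ^ 2 - τ * (a * b)) ≤ 0 := by
  have hab : 0 ≤ a * b := mul_nonneg_of_nonpos_of_nonpos ha hb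
  have : √(a ^ 2 + b ^ 2 - τ * (a * b)) ≤ -(a + b) := by
    apply Real.sqrt_le_iff.mpr
    constructor
    · linarith
    · nlinarith [mul_nonneg hτ hab]
  linarith

/-- For `τ ∈ (0, 2]`, the positivity region of the R-union
`R₁ + R₂ + √(R₁² + R₂² − τR₁R₂)` is exactly the union of the positivity regions of
`R₁` and `R₂`. -/
theorem r_union_positivity {n : ℕ} (τ : ℝ) (hτ : τ ∈ Set.Ioc (0:ℝ) 2)
    (R₁ R₂ : (Fin n → ℝ) → ℝ) :
    {x : Fin n → ℝ |
        0 < R₁ x + R₂ x + Real.sqrt ((R₁ x) ^ 2 + (R₂ x) ^ 2 - τ * (R₁ x * R₂ x))} =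
      {x : Fin n → ℝ | 0 < R₁ x} ∪ {x : Fin n → ℝ | 0 < R₂ x} := by
  ext x
  simp only [Set.mem_ofPred_eq, Set.mem_union]
  constructor
  · contrapose!
    rintro ⟨h₁, h₂⟩
    exact add_add_sqrt_nonpos hτ.1.le h₁ h₂
  · rintro (h | h)
    · exact add_add_sqrt_pos_of_pos hτ.1 h
    · rw [add_comm (R₁ x), add_comm (R₁ x ^ 2), mul_comm (R₁ x)]
      exact add_add_sqrt_pos_of_pos hτ.1 h
end

section
/- Let τ ∈ (0, 2] and let R₁, R₂ : ℝⁿ → ℝ. Define R_∩(R₁,R₂)(x) := R₁(x) + R₂(x) − √(R₁(x)² + R₂(x)² − τ R₁(x) R₂(x)). Then {x ∈ ℝⁿ : R_∩(R₁,R₂)(x) > 0} = {x ∈ ℝⁿ : R₁(x) > 0} ∩ {x ∈ ℝⁿ : R₂(x) > 0}; that is, the R-intersection represents the set-theoretic intersection of the positivity regions of R₁ and R₂. -/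
/-- For `τ ∈ (0, 2]`, the positivity region of the R-intersection
`R₁ + R₂ − √(R₁² + R₂² − τR₁R₂)` is exactly the intersection of the positivity regions
of `R₁` and `R₂`. -/
theorem r_inter_positivity {n : ℕ} (τ : ℝ) (hτ : τ ∈ Set.Ioc (0:ℝ) 2)
    (R₁ R₂ : (Fin n → ℝ) → ℝ) :
    {x : Fin n → ℝ |
        0 < R₁ x + R₂ x - Real.sqrt ((R₁ x) ^ 2 + (R₂ x) ^ 2 - τ * (R₁ x * R₂ x))} =
      {x : Fin n → ℝ | 0 < R₁ x} ∩ {x : Fin n → ℝ | 0 < R₂ x} := by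
  have hτ₀ : 0 < 2 + τ := by linarith [hτ.1]
  ext x
  simp only [Set.mem_ofPred_eq, Set.mem_inter_iff, sub_pos]
  constructor
  · intro h
    have hsum : 0 < R₁ x + R₂ x := (Real.sqrt_nonneg _).trans_lt h
    rw [Real.sqrt_lt' hsum] at h
    have hprod : 0 < R₁ x * R₂ x :=
      pos_of_mul_pos_right (a := 2 + τ) (by linarith) hτ₀.le
    rcases mul_pos_iff.mp hprod with hpos | hneg
    · exact hpos
    · linarith [hneg.1, hneg.2]
  · rintro ⟨h₁, h₂⟩
    rw [Real.sqrt_lt' (add_pos h₁ h₂)]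
    linarith [mul_pos hτ₀ (mul_pos h₁ h₂)]
end

section
/- The set {(x₁, x₂) ∈ ℝ² : x₁x₂ < 1} is positively invariant for the Hahn system ẋ₁ = −x₁ + 2x₁²x₂, ẋ₂ = −x₂: every solution with x₁(0)x₂(0) < 1 satisfies x₁(t)x₂(t) < 1 for all t ≥ 0 in its interval of existence. -/
/-- A scalar solution of `v' = a v` with bounded coefficient that vanishes at the right end of an
interval vanishes at the left end. -/
theorem eq_zero_left_of_hasDerivAt_mul {v a : ℝ → ℝ} {s K : ℝ} (hs : 0 ≤ s)
    (hv : ∀ t ∈ Set.Icc (0:ℝ) s, HasDerivAt v (a t * v t) t)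
    (ha : ∀ t ∈ Set.Icc (0:ℝ) s, |a t| ≤ K) (hvs : v s = 0) : v 0 = 0 := by
  have hd : ∀ t ∈ Set.Icc (0:ℝ) s, HasDerivAt (fun t => v t ^ 2 * Real.exp (2 * K * t))
      (2 * (a t + K) * (v t ^ 2 * Real.exp (2 * K * t))) t := by
    intro t ht
    have h := ((hv t ht).pow 2).mul (((hasDerivAt_id t).const_mul (2 * K)).exp)
    refine h.congr_deriv ?_
    simp
    ring
  have hmono : MonotoneOn (fun t => v t ^ 2 * Real.exp (2 * K * t)) (Set.Icc 0 s) := by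
    refine monotoneOn_of_deriv_nonneg (convex_Icc 0 s)
      (fun t ht => (hd t ht).continuousAt.continuousWithinAt)
      (fun t ht => (hd t (interior_subset ht)).differentiableAt.differentiableWithinAt) ?_
    intro t ht
    rw [(hd t (interior_subset ht)).deriv]
    have := (abs_le.mp (ha t (interior_subset ht))).1
    have : 0 ≤ a t + K := by linarith
    positivity
  have h := hmono (Set.left_mem_Icc.mpr hs) (Set.right_mem_Icc.mpr hs) hs
  simp only [hvs, mul_zero, Real.exp_zero, mul_one] at h
  exact pow_eq_zero_iff two_ne_zero |>.mp (le_antisymm (by simpa using h) (sq_nonneg _))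


/-- The set `{x₁x₂ < 1}` is positively invariant for the Hahn system
`ẋ₁ = −x₁ + 2x₁²x₂`, `ẋ₂ = −x₂`: any solution defined on `[0, T]` with
`x₁(0)·x₂(0) < 1` satisfies `x₁(t)·x₂(t) < 1` for all `t ∈ [0, T]`. -/
theorem hahn_sublevel_invariant (x₁ x₂ : ℝ → ℝ) (T : ℝ)
    (h₁ : ∀ t ∈ Set.Icc (0:ℝ) T,
      HasDerivAt x₁ (-x₁ t + 2 * (x₁ t) ^ 2 * x₂ t) t)
    (h₂ : ∀ t ∈ Set.Icc (0:ℝ) T, HasDerivAt x₂ (-x₂ t) t)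
    (h0 : x₁ 0 * x₂ 0 < 1) :
    ∀ t ∈ Set.Icc (0:ℝ) T, x₁ t * x₂ t < 1 := by
  intro t ht
  by_contra! hlt
  have hv : ∀ r ∈ Set.Icc (0:ℝ) t, HasDerivAt (fun r => 1 - x₁ r * x₂ r)
      (2 * (x₁ r * x₂ r) * (1 - x₁ r * x₂ r)) r := by
    intro r hr
    have hr' : r ∈ Set.Icc (0:ℝ) T := ⟨hr.1, hr.2.trans ht.2⟩
    refine (((h₁ r hr').mul (h₂ r hr')).const_sub 1).congr_deriv ?_
    ring
  have hcont : ContinuousOn (fun r => 1 - x₁ r * x₂ r) (Set.Icc 0 t) :=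
    fun r hr => (hv r hr).continuousAt.continuousWithinAt
  obtain ⟨s, hs, hs0⟩ := intermediate_value_Icc' ht.1 hcont
    (show (0:ℝ) ∈ Set.Icc (1 - x₁ t * x₂ t) (1 - x₁ 0 * x₂ 0) from ⟨by linarith, by linarith⟩)
  have hcoeff : ContinuousOn (fun r => 2 * (x₁ r * x₂ r)) (Set.Icc 0 t) :=
    ((continuousOn_const (c := (2:ℝ))).mul (continuousOn_const (c := (1:ℝ)) |>.sub hcont)).congr
      fun r _ => by simp
  obtain ⟨K, hK⟩ := isCompact_Icc.exists_bound_of_continuousOn hcoeff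
  have hsub : Set.Icc (0:ℝ) s ⊆ Set.Icc 0 t := Set.Icc_subset_Icc_right hs.2
  have := eq_zero_left_of_hasDerivAt_mul hs.1 (fun r hr => hv r (hsub hr))
    (fun r hr => hK r (hsub hr)) hs0
  linarith
end
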